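/- arXiv:2202.04859 — 11 statements merged into one kernel-verified Lean document; each statement's English description precedes it below -/
import Mathlib

section
/- Let f_1, …, f_p : ℝⁿ → ℝ (p ≥ 1) be functions that are differentiable at a point x̄ ∈ ℝⁿ. If x̄ is locally weakly Pareto optimal, i.e. there exists an open neighborhood U of x̄ such that there is no x ∈ U with f_i(x) < f_i(x̄) for all i ∈ {1,…,p}, then x̄ is Pareto critical, i.e. for every direction d ∈ ℝⁿ there exists an index j ∈ {1,…,p} with ⟨∇f_j(x̄), d⟩ ≥ 0. -/
open scoped RealInnerProductSpace

/-- A function whose directional derivative at `x` along `d` is negative decreases strictly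
for all sufficiently small positive steps along `d`. -/
theorem HasGradientAt.eventually_lt_of_inner_neg {E : Type*} [NormedAddCommGroup E]
    [InnerProductSpace ℝ E] [CompleteSpace E] {f : E → ℝ} {g x d : E}
    (hf : HasGradientAt f g x) (hd : ⟪g, d⟫ < 0) :
    ∀ᶠ t : ℝ in nhdsWithin 0 (Set.Ioi 0), f (x + t • d) < f x := by
  have hline : HasLineDerivAt ℝ f ⟪g, d⟫ x d := by
    simpa using hf.hasFDerivAt.hasLineDerivAt d
  filter_upwards [hline.tendsto_slope_zero_right.eventually_lt_const hd,
    self_mem_nhdsWithin] with t ht ht0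
  have ht0' : 0 < t := ht0
  rw [smul_eq_mul] at ht
  linarith [neg_of_mul_neg_right ht (inv_pos.mpr ht0').le]

/-- If `xbar` is locally weakly Pareto optimal for differentiable objectives
`f 0, …, f (p-1)`, then `xbar` is Pareto critical. -/
theorem locally_weak_pareto_optimal_implies_pareto_critical
    (n p : ℕ) (hp : 1 ≤ p)
    (f : Fin p → EuclideanSpace ℝ (Fin n) → ℝ)
    (xbar : EuclideanSpace ℝ (Fin n))
    (hdiff : ∀ i, DifferentiableAt ℝ (f i) xbar)
    (hopt : ∃ U : Set (EuclideanSpace ℝ (Fin n)), IsOpen U ∧ xbar ∈ U ∧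
      ¬ ∃ x ∈ U, ∀ i, f i x < f i xbar) :
    ∀ d : EuclideanSpace ℝ (Fin n), ∃ j : Fin p, ⟪gradient (f j) xbar, d⟫ ≥ 0 := by
  intro d
  obtain ⟨U, hU, hxU, hno⟩ := hopt
  by_contra! hneg
  have hline : Filter.Tendsto (fun t : ℝ => xbar + t • d) (nhdsWithin 0 (Set.Ioi 0))
      (nhds xbar) := by
    have hcont : Continuous fun t : ℝ => xbar + t • d := by fun_prop
    simpa using (hcont.tendsto 0).mono_left nhdsWithin_le_nhds
  have hdesc : ∀ᶠ t : ℝ in nhdsWithin 0 (Set.Ioi 0), ∀ i, f i (xbar + t • d) < f i xbar :=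
    Filter.eventually_all.mpr fun i =>
      (hdiff i).hasGradientAt.eventually_lt_of_inner_neg (hneg i)
  obtain ⟨t, htU, ht⟩ := ((hline.eventually_mem (hU.mem_nhds hxU)).and hdesc).exists
  exact hno ⟨_, htU, ht⟩
end

section
/- Let f_1, …, f_p : ℝⁿ → ℝ (p ≥ 1) be continuously differentiable. Then the function ω : ℝⁿ → ℝ defined by ω(x) := − inf { max_{i=1,…,p} ⟨∇f_i(x), d⟩ : d ∈ ℝⁿ, ‖d‖ ≤ 1 } is continuous on ℝⁿ. -/
open scoped RealInnerProductSpace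

theorem ContDiff.continuous_gradient {F : Type*} [NormedAddCommGroup F] [InnerProductSpace ℝ F]
    [CompleteSpace F] {f : F → ℝ} (hf : ContDiff ℝ 1 f) : Continuous (gradient f) :=
  (InnerProductSpace.toDual ℝ F).symm.continuous.comp (hf.continuous_fderiv one_ne_zero)

/-- For continuously differentiable objectives `f 0, …, f (p-1)`, the criticality
measure `ω(x) = − inf { max_i ⟪∇fᵢ(x), d⟫ : ‖d‖ ≤ 1 }` is continuous. -/
theorem omega_continuous
    (n p : ℕ) (hp : 1 ≤ p)
    (f : Fin p → EuclideanSpace ℝ (Fin n) → ℝ)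
    (hf : ∀ i, ContDiff ℝ 1 (f i)) :
    Continuous (fun x : EuclideanSpace ℝ (Fin n) =>
      - sInf ((fun d => ⨆ i : Fin p, ⟪gradient (f i) x, d⟫) ''
        Metric.closedBall (0 : EuclideanSpace ℝ (Fin n)) 1)) := by
  have : Nonempty (Fin p) := ⟨⟨0, hp⟩⟩
  refine ((isCompact_closedBall (0 : EuclideanSpace ℝ (Fin n)) 1).continuous_sInf ?_).neg
  simp only [← Finset.sup'_univ_eq_ciSup]
  refine Continuous.finset_sup'_apply Finset.univ_nonempty fun i _ => ?_
  exact ((hf i).continuous_gradient.comp continuous_fst).inner continuous_snd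
end

section
/- Let f_1, …, f_p : ℝⁿ → ℝ (p ≥ 1) be continuously differentiable, let x ∈ ℝⁿ be not Pareto critical, and let d_ω be any minimizer of the function d ↦ max_{i=1,…,p} ⟨∇f_i(x), d⟩ over the closed unit ball {d : ‖d‖ ≤ 1}. Then d_ω is a common descent direction at x: there exists t₀ > 0 such that f_i(x + t·d_ω) < f_i(x) for all t ∈ (0, t₀] and all i ∈ {1,…,p}. -/
open scoped RealInnerProductSpace

open Filter Topology in
/-- A function with negative derivative at `0` is below its value at `0` immediately to the right. -/
theorem HasDerivAt.eventually_lt_nhdsGT_zero {g : ℝ → ℝ} {g' : ℝ}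
    (hg : HasDerivAt g g' 0) (hneg : g' < 0) : ∀ᶠ t in 𝓝[>] (0 : ℝ), g t < g 0 := by
  have hslope := (hg.tendsto_slope.eventually_lt_const hneg).filter_mono
    (nhdsWithin_mono (0 : ℝ) fun t (ht : 0 < t) => ht.ne')
  filter_upwards [hslope, self_mem_nhdsWithin] with t hlt (ht : 0 < t)
  rw [slope_def_field, sub_zero] at hlt
  exact sub_neg.mp (by simpa using (div_lt_iff₀ ht).mp hlt)

open Filter Topology in
/-- A direction making a negative inner product with the gradient is a descent direction. -/
theorem eventually_lt_of_inner_gradient_neg {E : Type*} [NormedAddCommGroup E]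
    [InnerProductSpace ℝ E] [CompleteSpace E] {f : E → ℝ} {x d : E}
    (hf : DifferentiableAt ℝ f x) (hd : ⟪gradient f x, d⟫ < 0) :
    ∀ᶠ t in 𝓝[>] (0 : ℝ), f (x + t • d) < f x := by
  have hderiv : HasDerivAt (fun t : ℝ => f (x + t • d)) ⟪gradient f x, d⟫ 0 := by
    have h := hf.hasGradientAt.hasFDerivAt.hasLineDerivAt d
    simpa [HasLineDerivAt] using h
  simpa using hderiv.eventually_lt_nhdsGT_zero hd

/-- If some direction has negative inner product with every `v i`, so does some direction in the
closed unit ball. -/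
theorem exists_norm_le_one_forall_inner_neg {E ι : Type*} [NormedAddCommGroup E]
    [InnerProductSpace ℝ E] {v : ι → E} {d : E} (hd : ∀ i, ⟪v i, d⟫ < 0) :
    ∃ e : E, ‖e‖ ≤ 1 ∧ ∀ i, ⟪v i, e⟫ < 0 := by
  have hpos : 0 < 1 + ‖d‖ := by positivity
  refine ⟨(1 + ‖d‖)⁻¹ • d, ?_, fun i => ?_⟩
  · rw [norm_smul, norm_inv, Real.norm_of_nonneg hpos.le, inv_mul_le_one₀ hpos]
    linarith
  · rw [real_inner_smul_right]
    exact mul_neg_of_pos_of_neg (inv_pos.mpr hpos) (hd i)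

/-- If `x` is not Pareto critical and `dω` minimizes `d ↦ max_i ⟪∇fᵢ(x), d⟫` over the
closed unit ball, then `dω` is a common descent direction at `x`. -/
theorem descent_direction_of_not_pareto_critical
    (n p : ℕ) (hp : 1 ≤ p)
    (f : Fin p → EuclideanSpace ℝ (Fin n) → ℝ)
    (hf : ∀ i, ContDiff ℝ 1 (f i))
    (x : EuclideanSpace ℝ (Fin n))
    (hnotcrit : ¬ ∀ d : EuclideanSpace ℝ (Fin n), ∃ j : Fin p, ⟪gradient (f j) x, d⟫ ≥ 0)
    (dω : EuclideanSpace ℝ (Fin n)) (hdω : ‖dω‖ ≤ 1)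
    (hmin : ∀ d : EuclideanSpace ℝ (Fin n), ‖d‖ ≤ 1 →
      (⨆ i : Fin p, ⟪gradient (f i) x, dω⟫) ≤ ⨆ i : Fin p, ⟪gradient (f i) x, d⟫) :
    ∃ t₀ > (0 : ℝ), ∀ t ∈ Set.Ioc (0 : ℝ) t₀, ∀ i : Fin p, f i (x + t • dω) < f i x := by
  push Not at hnotcrit
  obtain ⟨d, hd⟩ := hnotcrit
  obtain ⟨e, he, hneg⟩ := exists_norm_le_one_forall_inner_neg hd
  have : Nonempty (Fin p) := Fin.pos_iff_nonempty.mp hp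
  obtain ⟨j, hj⟩ := exists_eq_ciSup_of_finite (f := fun i : Fin p => ⟪gradient (f i) x, e⟫)
  have hdescent (i : Fin p) : ⟪gradient (f i) x, dω⟫ < 0 :=
    calc ⟪gradient (f i) x, dω⟫
      _ ≤ ⨆ i : Fin p, ⟪gradient (f i) x, dω⟫ :=
        le_ciSup (f := fun i : Fin p => ⟪gradient (f i) x, dω⟫) (Set.finite_range _).bddAbove i
      _ ≤ ⨆ i : Fin p, ⟪gradient (f i) x, e⟫ := hmin e he
      _ = ⟪gradient (f j) x, e⟫ := hj.symm
      _ < 0 := hneg j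
  have hall := Filter.eventually_all.mpr fun i => eventually_lt_of_inner_gradient_neg
    ((hf i).differentiable one_ne_zero x) (hdescent i)
  obtain ⟨t₀, ht₀, hsub⟩ := mem_nhdsGT_iff_exists_Ioc_subset.mp hall
  exact ⟨t₀, ht₀, hsub⟩
end

section
/- Let f_1, …, f_p : ℝⁿ → ℝ (p ≥ 1) be continuously differentiable and x ∈ ℝⁿ. Then there exist scalars α_1, …, α_p ∈ [0,1] with α_1 + ⋯ + α_p = 1, a scalar μ ≥ 0, and a minimizer d_ω of d ↦ max_{i=1,…,p} ⟨∇f_i(x), d⟩ over the closed unit ball {d : ‖d‖ ≤ 1}, such that: d_ω = −μ · Σ_{i=1}^p α_i ∇f_i(x); ω(x) ≤ ‖Σ_{i=1}^p α_i ∇f_i(x)‖; if x is not Pareto critical then ‖d_ω‖ = 1; and if x is Pareto critical then d_ω = 0 and Σ_{i=1}^p α_i ∇f_i(x) = 0. -/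
open scoped RealInnerProductSpace

section

variable {ι E : Type*} [Fintype ι] [NormedAddCommGroup E] [InnerProductSpace ℝ E]

/-- The convex hull of a nonempty finite family `g` contains a point `v` of least norm, which is
characterized by `‖v‖ ^ 2 ≤ ⟪g i, v⟫` for all `i`. -/
theorem exists_stdSimplex_norm_sq_le_inner [Nonempty ι] (g : ι → E) :
    ∃ α ∈ stdSimplex ℝ ι, ∀ i, ‖∑ j, α j • g j‖ ^ 2 ≤ ⟪g i, ∑ j, α j • g j⟫ := by
  classical
  let L : (ι → ℝ) →ₗ[ℝ] E := Fintype.linearCombination ℝ g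
  have hL : Continuous L := L.continuous_on_pi
  have hmem (i : ι) : g i ∈ L '' stdSimplex ℝ ι :=
    ⟨Pi.single i 1, single_mem_stdSimplex ℝ i, by simp [L]⟩
  have hconv : Convex ℝ (L '' stdSimplex ℝ ι) := (convex_stdSimplex ℝ ι).linear_image L
  obtain ⟨v, ⟨α, hα, rfl⟩, hv⟩ := exists_norm_eq_iInf_of_complete_convex
    ⟨_, hmem (Classical.arbitrary ι)⟩ ((isCompact_stdSimplex ℝ ι).image hL).isComplete hconv 0
  refine ⟨α, hα, fun i => ?_⟩
  have h := (norm_eq_iInf_iff_real_inner_le_zero hconv ⟨α, hα, rfl⟩).1 hv (g i) (hmem i)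
  rw [zero_sub, inner_neg_left, inner_sub_right, real_inner_self_eq_norm_sq,
    real_inner_comm] at h
  change ‖L α‖ ^ 2 ≤ ⟪g i, L α⟫
  linarith

/-- A linear functional at a convex combination is at most the maximum of its values at the
points. -/
theorem inner_sum_smul_le_iSup {α : ι → ℝ} (hα : α ∈ stdSimplex ℝ ι) (g : ι → E) (d : E) :
    ⟪∑ i, α i • g i, d⟫ ≤ ⨆ i, ⟪g i, d⟫ := by
  calc ⟪∑ i, α i • g i, d⟫ = ∑ i, α i * ⟪g i, d⟫ := by simp [sum_inner, real_inner_smul_left]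
    _ ≤ ∑ i, α i * ⨆ i, ⟪g i, d⟫ := Finset.sum_le_sum fun i _ =>
        mul_le_mul_of_nonneg_left
          (le_ciSup (Set.finite_range fun i => ⟪g i, d⟫).bddAbove i) (hα.1 i)
    _ = ⨆ i, ⟪g i, d⟫ := by rw [← Finset.sum_mul, hα.2, one_mul]

end

/-- Representation of a minimizer of `d ↦ max_i ⟪∇fᵢ(x), d⟫` over the closed unit ball:
there are convex multipliers `α` and `μ ≥ 0` with `dω = −μ • Σ αᵢ ∇fᵢ(x)`,
`ω(x) ≤ ‖Σ αᵢ ∇fᵢ(x)‖`; if `x` is not Pareto critical then `‖dω‖ = 1`, and if `x` is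
Pareto critical then `dω = 0` and `Σ αᵢ ∇fᵢ(x) = 0`. -/
theorem minimizer_representation
    (n p : ℕ) (hp : 1 ≤ p)
    (f : Fin p → EuclideanSpace ℝ (Fin n) → ℝ)
    (hf : ∀ i, ContDiff ℝ 1 (f i))
    (x : EuclideanSpace ℝ (Fin n)) :
    ∃ (α : Fin p → ℝ) (μ : ℝ) (dω : EuclideanSpace ℝ (Fin n)),
      (∀ i, α i ∈ Set.Icc (0 : ℝ) 1) ∧ (∑ i, α i = 1) ∧ 0 ≤ μ ∧
      ‖dω‖ ≤ 1 ∧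
      (∀ d : EuclideanSpace ℝ (Fin n), ‖d‖ ≤ 1 →
        (⨆ i : Fin p, ⟪gradient (f i) x, dω⟫) ≤ ⨆ i : Fin p, ⟪gradient (f i) x, d⟫) ∧
      dω = (-μ) • ∑ i, α i • gradient (f i) x ∧
      (- sInf ((fun d => ⨆ i : Fin p, ⟪gradient (f i) x, d⟫) ''
          Metric.closedBall (0 : EuclideanSpace ℝ (Fin n)) 1))
        ≤ ‖∑ i, α i • gradient (f i) x‖ ∧
      ((¬ ∀ d : EuclideanSpace ℝ (Fin n), ∃ j : Fin p, ⟪gradient (f j) x, d⟫ ≥ 0) →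
        ‖dω‖ = 1) ∧
      ((∀ d : EuclideanSpace ℝ (Fin n), ∃ j : Fin p, ⟪gradient (f j) x, d⟫ ≥ 0) →
        dω = 0 ∧ ∑ i, α i • gradient (f i) x = 0) := by
  have : Nonempty (Fin p) := ⟨⟨0, hp⟩⟩
  obtain ⟨α, hα, hmin⟩ := exists_stdSimplex_norm_sq_le_inner fun i => gradient (f i) x
  have hle := inner_sum_smul_le_iSup hα fun i => gradient (f i) x
  set v := ∑ i, α i • gradient (f i) x
  have hlow (d : EuclideanSpace ℝ (Fin n)) (hd : ‖d‖ ≤ 1) :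
      -‖v‖ ≤ ⨆ i : Fin p, ⟪gradient (f i) x, d⟫ := by
    have h := neg_le_of_abs_le (abs_real_inner_le_norm v d)
    nlinarith [hle d, norm_nonneg v]
  have hopt : (⨆ i : Fin p, ⟪gradient (f i) x, (-‖v‖⁻¹) • v⟫) ≤ -‖v‖ := by
    refine ciSup_le fun i => ?_
    have h := mul_le_mul_of_nonneg_left (hmin i) (inv_nonneg.2 (norm_nonneg v))
    have h' : ‖v‖⁻¹ * ‖v‖ ^ 2 = ‖v‖ := by
      rcases eq_or_ne ‖v‖ 0 with h0 | h0
      · simp [h0]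
      · field_simp
    rw [real_inner_smul_right]
    linarith
  refine ⟨α, ‖v‖⁻¹, (-‖v‖⁻¹) • v, fun i => mem_Icc_of_mem_stdSimplex hα i, hα.2, by positivity,
    ?_, fun d hd => hopt.trans (hlow d hd), rfl, ?_, fun hcrit => ?_, fun hcrit => ?_⟩
  · rw [norm_smul, norm_neg, norm_inv, norm_norm]
    exact inv_mul_le_one
  · rw [neg_le]
    refine le_csInf ((Metric.nonempty_closedBall.2 zero_le_one).image _) ?_
    rintro _ ⟨d, hd, rfl⟩
    exact hlow d (mem_closedBall_zero_iff.1 hd)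
  · have hv0 : v ≠ 0 := by
      intro h0
      push Not at hcrit
      obtain ⟨d, hd⟩ := hcrit
      obtain ⟨j, hj⟩ := exists_eq_ciSup_of_finite (f := fun i => ⟪gradient (f i) x, d⟫)
      have h := hle d
      rw [h0, inner_zero_left, ← hj] at h
      exact (hd j).not_ge h
    rw [norm_smul, norm_neg, norm_inv, norm_norm, inv_mul_cancel₀ (norm_ne_zero_iff.2 hv0)]
  · obtain ⟨j, hj⟩ := hcrit (-v)
    rw [inner_neg_right] at hj
    have hv0 : v = 0 := by
      rw [← norm_eq_zero, ← sq_eq_zero_iff]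
      nlinarith [hmin j, sq_nonneg ‖v‖]
    exact ⟨by rw [hv0, smul_zero], hv0⟩
end

section
/- Let m_1, …, m_p : ℝⁿ → ℝ (p ≥ 1) be continuous, let B ⊆ ℝⁿ be nonempty and compact, let a ∈ ℝᵖ, and let r ∈ ℝᵖ with r_i > 0 for every i. Suppose (t⁺, x⁺) is a global minimizer of the Pascoletti–Serafini scalarization: x⁺ ∈ B, m_i(x⁺) ≤ a_i + t⁺ r_i for all i, and t⁺ ≤ t for every (t, x) with x ∈ B and m_i(x) ≤ a_i + t r_i for all i. Then x⁺ is weakly efficient for the problem of minimizing (m_1,…,m_p) over B: there is no x ∈ B with m_i(x) < m_i(x⁺) for all i ∈ {1,…,p}. -/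
/-- A global minimizer `(t⁺, x⁺)` of the Pascoletti–Serafini scalarization with
positive direction `r` yields a weakly efficient point `x⁺` for minimizing
`(m 0, …, m (p-1))` over `B`. -/
theorem pascoletti_serafini_global_min_weakly_efficient
    (n p : ℕ) (hp : 1 ≤ p)
    (m : Fin p → EuclideanSpace ℝ (Fin n) → ℝ) (hm : ∀ i, Continuous (m i))
    (B : Set (EuclideanSpace ℝ (Fin n))) (hB : B.Nonempty) (hBc : IsCompact B)
    (a r : Fin p → ℝ) (hr : ∀ i, 0 < r i)
    (tplus : ℝ) (xplus : EuclideanSpace ℝ (Fin n))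
    (hxB : xplus ∈ B) (hfeas : ∀ i, m i xplus ≤ a i + tplus * r i)
    (hmin : ∀ (t : ℝ) (x : EuclideanSpace ℝ (Fin n)), x ∈ B →
      (∀ i, m i x ≤ a i + t * r i) → tplus ≤ t) :
    ¬ ∃ x ∈ B, ∀ i, m i x < m i xplus := by
  rintro ⟨x, hx, hlt⟩
  have : Nonempty (Fin p) := ⟨⟨0, hp⟩⟩
  obtain ⟨j, hj⟩ := Finite.exists_max fun i => (m i x - a i) / r i
  have hle : tplus ≤ (m j x - a j) / r j := by
    refine hmin _ x hx fun i => ?_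
    have := (div_le_iff₀ (hr i)).mp (hj i)
    linarith
  have := (le_div_iff₀ (hr j)).mp hle
  linarith [hlt j, hfeas j]
end

section
/- Let m_1, …, m_p : ℝⁿ → ℝ (p ≥ 1) be continuous, let B ⊆ ℝⁿ be nonempty and compact, let a ∈ ℝᵖ, and let r ∈ ℝᵖ with r_i > 0 for every i. Suppose (t⁺, x⁺) is a local minimizer of the Pascoletti–Serafini scalarization: x⁺ ∈ B, m_i(x⁺) ≤ a_i + t⁺ r_i for all i, and there is ε > 0 such that t⁺ ≤ t for every (t, x) with x ∈ B, |t − t⁺| < ε, ‖x − x⁺‖ < ε, and m_i(x) ≤ a_i + t r_i for all i. Then x⁺ is locally weakly efficient for minimizing (m_1,…,m_p) over B: there exists an open neighborhood U of x⁺ such that no x ∈ U ∩ B satisfies m_i(x) < m_i(x⁺) for all i ∈ {1,…,p}. -/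
/-- A local minimizer `(t⁺, x⁺)` of the Pascoletti–Serafini scalarization with
positive direction `r` yields a locally weakly efficient point `x⁺` for minimizing
`(m 0, …, m (p-1))` over `B`. -/
theorem pascoletti_serafini_local_min_locally_weakly_efficient
    (n p : ℕ) (hp : 1 ≤ p)
    (m : Fin p → EuclideanSpace ℝ (Fin n) → ℝ) (hm : ∀ i, Continuous (m i))
    (B : Set (EuclideanSpace ℝ (Fin n))) (hB : B.Nonempty) (hBc : IsCompact B)
    (a r : Fin p → ℝ) (hr : ∀ i, 0 < r i)
    (tplus : ℝ) (xplus : EuclideanSpace ℝ (Fin n))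
    (hxB : xplus ∈ B) (hfeas : ∀ i, m i xplus ≤ a i + tplus * r i)
    (hlocmin : ∃ ε > (0 : ℝ), ∀ (t : ℝ) (x : EuclideanSpace ℝ (Fin n)), x ∈ B →
      |t - tplus| < ε → ‖x - xplus‖ < ε →
      (∀ i, m i x ≤ a i + t * r i) → tplus ≤ t) :
    ∃ U : Set (EuclideanSpace ℝ (Fin n)), IsOpen U ∧ xplus ∈ U ∧
      ¬ ∃ x ∈ U ∩ B, ∀ i, m i x < m i xplus := by
  obtain ⟨ε, hε, hmin⟩ := hlocmin
  refine ⟨Metric.ball xplus ε, Metric.isOpen_ball, Metric.mem_ball_self hε, ?_⟩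
  rintro ⟨x, ⟨hxU, hxB'⟩, hlt⟩
  have hcons : ∀ᶠ t in nhds tplus, ∀ i, m i x < a i + t * r i :=
    Filter.eventually_all.2 fun i =>
      (by fun_prop : Continuous fun t : ℝ => a i + t * r i).continuousAt.eventually_const_lt
        ((hlt i).trans_le (hfeas i))
  have hnear : ∀ᶠ t in nhds tplus, |t - tplus| < ε := eventually_abs_sub_lt tplus hε
  obtain ⟨t, ⟨hc, hn⟩, ht⟩ :=
    (((hcons.and hnear).filter_mono nhdsWithin_le_nhds).and
      (self_mem_nhdsWithin : Set.Iio tplus ∈ nhdsWithin tplus (Set.Iio tplus))).exists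
  exact not_le_of_gt ht (hmin t x hxB' hn (mem_ball_iff_norm.1 hxU) fun i => (hc i).le)
end

section
/- Let m_1, …, m_p : ℝⁿ → ℝ (p ≥ 1) be continuous, let B ⊆ ℝⁿ be nonempty and compact, let x₀ ∈ B, and set r_i := m_i(x₀) − inf_{x ∈ B} m_i(x) for each i. Assume x₀ is not weakly efficient for minimizing (m_1,…,m_p) over B, i.e. there exists x ∈ B with m_i(x) < m_i(x₀) for all i. Then every global minimizer (t⁺, x⁺) of the Pascoletti–Serafini scalarization with reference a = (m_1(x₀),…,m_p(x₀)) and direction r (minimize t subject to x ∈ B and m_i(x) ≤ m_i(x₀) + t r_i for all i) satisfies −1 ≤ t⁺ < 0. -/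
/-- If `x₀ ∈ B` is not weakly efficient for minimizing `(m 0, …, m (p-1))` over `B`,
then every global minimizer `(t⁺, x⁺)` of the Pascoletti–Serafini scalarization with
reference point `a = m(x₀)` and direction `rᵢ = mᵢ(x₀) − inf_B mᵢ` satisfies
`−1 ≤ t⁺ < 0`. -/
theorem pascoletti_serafini_min_value_mem_Ico
    (n p : ℕ) (hp : 1 ≤ p)
    (m : Fin p → EuclideanSpace ℝ (Fin n) → ℝ) (hm : ∀ i, Continuous (m i))
    (B : Set (EuclideanSpace ℝ (Fin n))) (hB : B.Nonempty) (hBc : IsCompact B)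
    (x₀ : EuclideanSpace ℝ (Fin n)) (hx₀ : x₀ ∈ B)
    (r : Fin p → ℝ) (hr : ∀ i, r i = m i x₀ - sInf (m i '' B))
    (hnoteff : ∃ x ∈ B, ∀ i, m i x < m i x₀)
    (tplus : ℝ) (xplus : EuclideanSpace ℝ (Fin n))
    (hxB : xplus ∈ B) (hfeas : ∀ i, m i xplus ≤ m i x₀ + tplus * r i)
    (hmin : ∀ (t : ℝ) (x : EuclideanSpace ℝ (Fin n)), x ∈ B →
      (∀ i, m i x ≤ m i x₀ + t * r i) → tplus ≤ t) :
    -1 ≤ tplus ∧ tplus < 0 := by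
  obtain ⟨x, hxmem, hx⟩ := hnoteff
  have hinf : ∀ i, ∀ y ∈ B, sInf (m i '' B) ≤ m i y := fun i y hy =>
    csInf_le (hBc.bddBelow_image (hm i).continuousOn) ⟨y, hy, rfl⟩
  have hrpos : ∀ i, 0 < r i := fun i => by
    have := hinf i x hxmem
    have := hx i
    rw [hr i]
    linarith
  refine ⟨?_, ?_⟩
  · have hi := hfeas ⟨0, hp⟩
    have hlb := hinf ⟨0, hp⟩ xplus hxB
    have hpos := hrpos ⟨0, hp⟩
    have hri := hr ⟨0, hp⟩
    by_contra! hlt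
    nlinarith
  · have hev : ∀ᶠ t in nhds (0 : ℝ), ∀ i, m i x < m i x₀ + t * r i := by
      rw [Filter.eventually_all]
      intro i
      have hcont : Continuous fun t : ℝ => m i x₀ + t * r i := by fun_prop
      exact hcont.continuousAt.eventually_const_lt (by simpa using hx i)
    obtain ⟨t, ht, htneg⟩ :=
      ((hev.filter_mono nhdsWithin_le_nhds).and
        (self_mem_nhdsWithin : Set.Iio (0 : ℝ) ∈ nhdsWithin 0 (Set.Iio 0))).exists
    exact (hmin t x hxmem fun i => (ht i).le).trans_lt htneg
end

section
/- Let f, m : ℝⁿ → ℝ be twice continuously differentiable, let x₀ ∈ ℝⁿ, δ > 0, and let c_f, c_m, κ_e > 0 be constants such that ‖∇²f(y)‖ ≤ c_f and ‖∇²m(y)‖ ≤ c_m for all y in the closed ball of radius δ centered at x₀, f(x₀) = m(x₀), and |f(y) − m(y)| ≤ κ_e δ² for all y in that closed ball. Then ‖∇f(x₀) − ∇m(x₀)‖ ≤ (κ_e + (c_f + c_m)/2) · δ. -/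
/-- Second-order Taylor estimate on a closed ball on which the second derivative is bounded. -/
theorem norm_sub_sub_fderiv_le_of_norm_iteratedFDeriv_two_le
    {E F : Type*} [NormedAddCommGroup E] [NormedSpace ℝ E]
    [NormedAddCommGroup F] [NormedSpace ℝ F] {f : E → F} (hf : ContDiff ℝ 2 f)
    {x : E} {r C : ℝ} (hC : ∀ y ∈ Metric.closedBall x r, ‖iteratedFDeriv ℝ 2 f y‖ ≤ C)
    {v : E} (hv : ‖v‖ ≤ r) :
    ‖f (x + v) - f x - fderiv ℝ f x v‖ ≤ C / 2 * ‖v‖ ^ 2 := by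
  have hd : Differentiable ℝ f := hf.differentiable (by norm_num)
  have hd' : Differentiable ℝ (fderiv ℝ f) :=
    (hf.fderiv_right (m := 1) (by norm_num)).differentiable (by norm_num)
  have hr : 0 ≤ r := (norm_nonneg v).trans hv
  have hball : ∀ t ∈ Set.Ico (0 : ℝ) 1, x + t • v ∈ Metric.closedBall x r := by
    intro t ht
    rw [mem_closedBall_iff_norm, add_sub_cancel_left, norm_smul, Real.norm_of_nonneg ht.1]
    exact (mul_le_of_le_one_left (norm_nonneg v) ht.2.le).trans hv
  have hlip : ∀ t ∈ Set.Ico (0 : ℝ) 1,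
      ‖fderiv ℝ f (x + t • v) - fderiv ℝ f x‖ ≤ C * (t * ‖v‖) := by
    intro t ht
    have h := (convex_closedBall x r).norm_image_sub_le_of_norm_fderiv_le (𝕜 := ℝ)
      (f := fderiv ℝ f) (C := C) (fun y _ => hd' y)
      (fun y hy => by
        rw [← norm_iteratedFDeriv_one, norm_iteratedFDeriv_fderiv]
        exact hC y hy)
      (Metric.mem_closedBall_self hr) (hball t ht)
    rwa [add_sub_cancel_left, norm_smul, Real.norm_of_nonneg ht.1] at h
  have hderiv : ∀ t : ℝ, HasDerivAt (fun t : ℝ => f (x + t • v) - f x - t • fderiv ℝ f x v)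
      ((fderiv ℝ f (x + t • v) - fderiv ℝ f x) v) t := by
    intro t
    have hline : HasDerivAt (fun t : ℝ => x + t • v) v t := by
      simpa using ((hasDerivAt_id t).smul_const v).const_add x
    have hlin : HasDerivAt (fun t : ℝ => t • fderiv ℝ f x v) (fderiv ℝ f x v) t := by
      simpa using (hasDerivAt_id t).smul_const (fderiv ℝ f x v)
    exact (((hd _).hasFDerivAt.comp_hasDerivAt t hline).sub_const (f x)).sub hlin
  have hB : ∀ t : ℝ, HasDerivAt (fun t : ℝ => C / 2 * ‖v‖ ^ 2 * t ^ 2) (C * ‖v‖ ^ 2 * t) t := by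
    intro t
    refine ((hasDerivAt_pow 2 t).const_mul (C / 2 * ‖v‖ ^ 2)).congr_deriv ?_
    push_cast
    ring
  have key := image_norm_le_of_norm_deriv_right_le_deriv_boundary (a := 0) (b := 1)
    (fun t _ => (hderiv t).continuousAt.continuousWithinAt)
    (fun t _ => (hderiv t).hasDerivWithinAt) (by simp) hB
    (fun t ht => by
      refine (ContinuousLinearMap.le_of_opNorm_le _ (hlip t ht) v).trans_eq ?_
      ring)
    (Set.right_mem_Icc.2 zero_le_one)
  simpa using key

/-- If a twice continuously differentiable model `m` interpolates `f` at `x₀`, both have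
Hessians bounded by `c_f`, `c_m` on the closed ball of radius `δ` around `x₀`, and the
model error is at most `κ_e δ²` on that ball, then the gradients at `x₀` differ by at
most `(κ_e + (c_f + c_m)/2) δ`. -/
theorem gradient_error_bound
    (n : ℕ) (f m : EuclideanSpace ℝ (Fin n) → ℝ)
    (hf : ContDiff ℝ 2 f) (hm : ContDiff ℝ 2 m)
    (x₀ : EuclideanSpace ℝ (Fin n)) (δ c_f c_m κ_e : ℝ)
    (hδ : 0 < δ) (hcf : 0 < c_f) (hcm : 0 < c_m) (hκe : 0 < κ_e)
    (hHf : ∀ y ∈ Metric.closedBall x₀ δ, ‖iteratedFDeriv ℝ 2 f y‖ ≤ c_f)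
    (hHm : ∀ y ∈ Metric.closedBall x₀ δ, ‖iteratedFDeriv ℝ 2 m y‖ ≤ c_m)
    (hinterp : f x₀ = m x₀)
    (herr : ∀ y ∈ Metric.closedBall x₀ δ, |f y - m y| ≤ κ_e * δ ^ 2) :
    ‖gradient f x₀ - gradient m x₀‖ ≤ (κ_e + (c_f + c_m) / 2) * δ := by
  have hgrad : ‖gradient f x₀ - gradient m x₀‖ = ‖fderiv ℝ f x₀ - fderiv ℝ m x₀‖ := by
    rw [gradient, gradient, ← map_sub, LinearIsometryEquiv.norm_map]
  rw [hgrad]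
  refine ContinuousLinearMap.opNorm_le_of_unit_norm (by positivity) fun u hu => ?_
  have hnorm : ‖δ • u‖ = δ := by rw [norm_smul, hu, mul_one, Real.norm_of_nonneg hδ.le]
  have hTf := norm_sub_sub_fderiv_le_of_norm_iteratedFDeriv_two_le hf hHf hnorm.le
  have hTm := norm_sub_sub_fderiv_le_of_norm_iteratedFDeriv_two_le hm hHm hnorm.le
  have he := herr (x₀ + δ • u) (by
    rw [mem_closedBall_iff_norm, add_sub_cancel_left]
    exact hnorm.le)
  rw [hnorm, map_smul, smul_eq_mul, Real.norm_eq_abs, abs_le] at hTf hTm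
  rw [abs_le] at he
  rw [sub_apply, Real.norm_eq_abs]
  refine le_of_mul_le_mul_left ?_ hδ
  rw [← abs_of_pos hδ, ← abs_mul, abs_of_pos hδ, abs_le]
  constructor <;> linarith [hTf.1, hTf.2, hTm.1, hTm.2, he.1, he.2]
end

section
/- Let g : ℝⁿ → ℝ be the quadratic function g(x) = c + ⟨b, x − x₀⟩ + (1/2)⟨x − x₀, A(x − x₀)⟩, where x₀ ∈ ℝⁿ, c ∈ ℝ, b ∈ ℝⁿ with b ≠ 0, and A : ℝⁿ → ℝⁿ is a symmetric continuous linear map. Let δ > 0, let d := −b/‖b‖, and set β := 1 + ‖A‖ (operator norm). Then inf_{t ∈ [−δ, δ]} g(x₀ + t·d) ≤ g(x₀) − (1/2)·‖b‖·min{ ‖b‖/β, δ }. In particular, any minimizer x_c of g along the segment {x₀ + t·d : |t| ≤ δ} satisfies g(x₀) − g(x_c) ≥ (1/2)·‖b‖·min{ ‖b‖/β, δ }. -/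
open scoped RealInnerProductSpace

/-- A quadratic restricted to the line through `x₀` in the normalized steepest-descent
direction is an explicit polynomial in the step length. -/
theorem quadratic_along_steepest_descent {E : Type*} [NormedAddCommGroup E]
    [InnerProductSpace ℝ E] {b : E} (hb : b ≠ 0) (A : E →L[ℝ] E) (x₀ : E) (c t : ℝ) {d : E}
    (hd : d = -(‖b‖⁻¹ • b)) :
    c + ⟪b, x₀ + t • d - x₀⟫ + (1 / 2) * ⟪x₀ + t • d - x₀, A (x₀ + t • d - x₀)⟫ =
      c - t * ‖b‖ + t ^ 2 / 2 * ⟪d, A d⟫ := by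
  have hb' : ‖b‖ ≠ 0 := norm_ne_zero_iff.mpr hb
  have hbd : ⟪b, d⟫ = -‖b‖ := by
    rw [hd, inner_neg_right, real_inner_smul_right, real_inner_self_eq_norm_sq]
    field_simp
  rw [add_sub_cancel_left, map_smul, real_inner_smul_right, real_inner_smul_left,
    real_inner_smul_right, hbd]
  ring

/-- The quadratic form of a continuous linear map at a unit vector is at most its norm. -/
theorem inner_map_self_le_opNorm {E : Type*} [NormedAddCommGroup E]
    [InnerProductSpace ℝ E] (A : E →L[ℝ] E) {d : E} (hd : ‖d‖ = 1) : ⟪d, A d⟫ ≤ ‖A‖ := by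
  have h := real_inner_le_norm d (A d)
  rw [hd, one_mul] at h
  exact h.trans (A.unit_le_opNorm d hd.le)

/-- One-dimensional Cauchy decrease at the step `min (r / β) δ`. -/
theorem quadratic_decrease_at_min_step {r β δ q : ℝ} (hr : 0 ≤ r) (hβ : 0 < β)
    (hδ : 0 ≤ δ) (hq : q ≤ β) (c : ℝ) :
    c - min (r / β) δ * r + min (r / β) δ ^ 2 / 2 * q ≤
      c - (1 / 2) * r * min (r / β) δ := by
  have hm : 0 ≤ min (r / β) δ := le_min (by positivity) hδ
  have hmβ : min (r / β) δ * β ≤ r := (le_div_iff₀ hβ).mp (min_le_left _ _)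
  nlinarith [mul_le_mul_of_nonneg_left hmβ hm,
    mul_le_mul_of_nonneg_left hq (sq_nonneg (min (r / β) δ))]

/-- Cauchy-type decrease for a quadratic along the normalized steepest-descent
direction: for `g(x) = c + ⟪b, x − x₀⟫ + ½⟪x − x₀, A(x − x₀)⟫` with `b ≠ 0`,
`d = −b/‖b‖` and `β = 1 + ‖A‖`, the infimum of `g` along `{x₀ + t d : |t| ≤ δ}` is at
most `g(x₀) − ½‖b‖ min{‖b‖/β, δ}`; in particular any minimizer along this segment
achieves at least this decrease. -/
theorem quadratic_cauchy_decrease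
    (n : ℕ) (x₀ b : EuclideanSpace ℝ (Fin n)) (c : ℝ) (hb : b ≠ 0)
    (A : EuclideanSpace ℝ (Fin n) →L[ℝ] EuclideanSpace ℝ (Fin n))
    (hA : ∀ u v : EuclideanSpace ℝ (Fin n), ⟪A u, v⟫ = ⟪u, A v⟫)
    (g : EuclideanSpace ℝ (Fin n) → ℝ)
    (hg : ∀ x, g x = c + ⟪b, x - x₀⟫ + (1 / 2) * ⟪x - x₀, A (x - x₀)⟫)
    (δ : ℝ) (hδ : 0 < δ) (d : EuclideanSpace ℝ (Fin n)) (hd : d = -(‖b‖⁻¹ • b))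
    (β : ℝ) (hβ : β = 1 + ‖A‖) :
    sInf ((fun t => g (x₀ + t • d)) '' Set.Icc (-δ) δ)
        ≤ g x₀ - (1 / 2) * ‖b‖ * min (‖b‖ / β) δ ∧
    ∀ t ∈ Set.Icc (-δ) δ,
      (∀ s ∈ Set.Icc (-δ) δ, g (x₀ + t • d) ≤ g (x₀ + s • d)) →
      g x₀ - g (x₀ + t • d) ≥ (1 / 2) * ‖b‖ * min (‖b‖ / β) δ := by
  have hline (t : ℝ) : g (x₀ + t • d) = c - t * ‖b‖ + t ^ 2 / 2 * ⟪d, A d⟫ :=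
    (hg _).trans (quadratic_along_steepest_descent hb A x₀ c t hd)
  have hg₀ : g x₀ = c := by simp [hg]
  have hβ₀ : 0 < β := by rw [hβ]; positivity
  have hd₁ : ‖d‖ = 1 := by
    rw [hd, norm_neg, norm_smul, norm_inv, norm_norm,
      inv_mul_cancel₀ (norm_ne_zero_iff.mpr hb)]
  have hq : ⟪d, A d⟫ ≤ β := by linarith [inner_map_self_le_opNorm A hd₁]
  have hm : min (‖b‖ / β) δ ∈ Set.Icc (-δ) δ :=
    ⟨(neg_nonpos.mpr hδ.le).trans (le_min (by positivity) hδ.le), min_le_right _ _⟩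
  have hdec : g (x₀ + min (‖b‖ / β) δ • d) ≤ g x₀ - (1 / 2) * ‖b‖ * min (‖b‖ / β) δ := by
    rw [hline, hg₀]
    exact quadratic_decrease_at_min_step (norm_nonneg b) hβ₀ hδ.le hq c
  refine ⟨?_, fun t _ hmin => by linarith [hmin _ hm]⟩
  have hcont : Continuous fun t : ℝ => g (x₀ + t • d) := by
    simp only [hline]
    fun_prop
  exact (csInf_le (isCompact_Icc.bddBelow_image hcont.continuousOn) ⟨_, hm, rfl⟩).trans hdec
end

section
/- Let m_1, …, m_p : ℝⁿ → ℝ (p ≥ 1) be continuous, let B ⊆ ℝⁿ be nonempty and compact, let x₀ ∈ B, and set r_i := m_i(x₀) − inf_{x ∈ B} m_i(x) for each i; assume r_i > 0 for every i. Let (t⁺, x⁺) be a global minimizer of the Pascoletti–Serafini scalarization with reference a = (m_1(x₀),…,m_p(x₀)) and direction r (minimize t subject to x ∈ B and m_i(x) ≤ m_i(x₀) + t r_i for all i). Then for every x_c ∈ B and every index i ∈ {1,…,p}: m_i(x₀) − m_i(x⁺) ≥ (min_{j} r_j / max_{j} r_j) · min_{j} ( m_j(x₀) − m_j(x_c) ).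 -/
/-- Lower bound on the model decrease obtained by a global minimizer of the
Pascoletti–Serafini scalarization: for every comparison point `x_c ∈ B` and every `i`,
`mᵢ(x₀) − mᵢ(x⁺) ≥ (min_j r_j / max_j r_j) · min_j (m_j(x₀) − m_j(x_c))`. -/
theorem pascoletti_serafini_decrease_bound
    (n p : ℕ) (hp : 1 ≤ p)
    (m : Fin p → EuclideanSpace ℝ (Fin n) → ℝ) (hm : ∀ i, Continuous (m i))
    (B : Set (EuclideanSpace ℝ (Fin n))) (hB : B.Nonempty) (hBc : IsCompact B)
    (x₀ : EuclideanSpace ℝ (Fin n)) (hx₀ : x₀ ∈ B)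
    (r : Fin p → ℝ) (hr : ∀ i, r i = m i x₀ - sInf (m i '' B))
    (hrpos : ∀ i, 0 < r i)
    (tplus : ℝ) (xplus : EuclideanSpace ℝ (Fin n))
    (hxB : xplus ∈ B) (hfeas : ∀ i, m i xplus ≤ m i x₀ + tplus * r i)
    (hmin : ∀ (t : ℝ) (x : EuclideanSpace ℝ (Fin n)), x ∈ B →
      (∀ i, m i x ≤ m i x₀ + t * r i) → tplus ≤ t) :
    ∀ x_c ∈ B, ∀ i : Fin p,
      m i x₀ - m i xplus ≥
        ((⨅ j : Fin p, r j) / (⨆ j : Fin p, r j)) *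
          ⨅ j : Fin p, (m j x₀ - m j x_c) := by
  intro x_c hx_c i
  set ρ := ⨅ j : Fin p, r j
  set R := ⨆ j : Fin p, r j
  set D := ⨅ j : Fin p, (m j x₀ - m j x_c)
  have hρ : ∀ j, ρ ≤ r j := fun j => ciInf_le (Set.finite_range r).bddBelow j
  have hR : ∀ j, r j ≤ R := fun j => le_ciSup (Set.finite_range r).bddAbove j
  have hD : ∀ j, D ≤ m j x₀ - m j x_c := fun j =>
    ciInf_le (Set.finite_range fun j => m j x₀ - m j x_c).bddBelow j
  have hρ0 : 0 ≤ ρ := Real.iInf_nonneg fun j => (hrpos j).le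
  have hRpos : 0 < R := (hrpos i).trans_le (hR i)
  have hi := hfeas i
  rcases le_total D 0 with hD0 | hD0
  · have ht : tplus ≤ 0 := hmin 0 x₀ hx₀ fun j => by simp
    have h₁ : ρ / R * D ≤ 0 := mul_nonpos_of_nonneg_of_nonpos (div_nonneg hρ0 hRpos.le) hD0
    have h₂ : tplus * r i ≤ 0 := mul_nonpos_of_nonpos_of_nonneg ht (hrpos i).le
    linarith
  · have hDR : 0 ≤ D / R := div_nonneg hD0 hRpos.le
    have hDRR : D / R * R = D := div_mul_cancel₀ D hRpos.ne'
    have ht : tplus ≤ -(D / R) := hmin _ x_c hx_c fun j => by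
      have h := mul_le_mul_of_nonneg_left (hR j) hDR
      linarith [hD j]
    have h₁ : tplus * r i ≤ -(D / R) * r i := mul_le_mul_of_nonneg_right ht (hrpos i).le
    have h₂ : D / R * ρ ≤ D / R * r i := mul_le_mul_of_nonneg_left (hρ i) hDR
    have h₃ : ρ / R * D = D / R * ρ := by ring
    linarith
end

section
/- Let f_1, …, f_p, m_1, …, m_p : ℝⁿ → ℝ (p ≥ 1), let x ∈ ℝⁿ, δ > 0, and let x⁺ lie in the closed ball of radius δ centered at x. Let κ_e > 0, κ_m ∈ (0,1), η₂ ∈ (0,1), and w > 0 be constants such that for every i: f_i(x) = m_i(x), |f_i(y) − m_i(y)| ≤ κ_e δ² for all y in the closed ball of radius δ centered at x, and m_i(x) − m_i(x⁺) ≥ κ_m · w · δ. If moreover δ ≤ κ_m (1 − η₂) w / κ_e, then for every i the reduction ratio satisfies ( f_i(x) − f_i(x⁺) ) / ( m_i(x) − m_i(x⁺) ) ≥ η₂; in particular min_{i=1,…,p} ( f_i(x) − f_i(x⁺) ) / ( m_i(x) − m_i(x⁺) ) ≥ η₂. -/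
/-- If the models `mᵢ` interpolate `fᵢ` at `x` with error at most `κ_e δ²` on the trust
region, the model decrease is at least `κ_m w δ`, and `δ ≤ κ_m (1 − η₂) w / κ_e`, then
every reduction ratio is at least `η₂`; in particular their minimum is at least `η₂`. -/
theorem very_successful_iteration
    (n p : ℕ) (hp : 1 ≤ p)
    (f m : Fin p → EuclideanSpace ℝ (Fin n) → ℝ)
    (x xplus : EuclideanSpace ℝ (Fin n)) (δ : ℝ) (hδ : 0 < δ)
    (hxplus : xplus ∈ Metric.closedBall x δ)
    (κ_e κ_m η₂ w : ℝ) (hκe : 0 < κ_e) (hκm : κ_m ∈ Set.Ioo (0 : ℝ) 1)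
    (hη : η₂ ∈ Set.Ioo (0 : ℝ) 1) (hw : 0 < w)
    (hinterp : ∀ i, f i x = m i x)
    (herr : ∀ i, ∀ y ∈ Metric.closedBall x δ, |f i y - m i y| ≤ κ_e * δ ^ 2)
    (hdec : ∀ i, m i x - m i xplus ≥ κ_m * w * δ)
    (hδle : δ ≤ κ_m * (1 - η₂) * w / κ_e) :
    (∀ i : Fin p, (f i x - f i xplus) / (m i x - m i xplus) ≥ η₂) ∧
    (⨅ i : Fin p, (f i x - f i xplus) / (m i x - m i xplus)) ≥ η₂ := by
  have hratio : ∀ i : Fin p, (f i x - f i xplus) / (m i x - m i xplus) ≥ η₂ := by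
    intro i
    have hpos : 0 < m i x - m i xplus :=
      (mul_pos (mul_pos hκm.1 hw) hδ).trans_le (hdec i)
    have hradius : κ_e * δ ^ 2 ≤ (1 - η₂) * (κ_m * w * δ) := by
      have h := mul_le_mul_of_nonneg_right ((le_div_iff₀ hκe).1 hδle) hδ.le
      linarith
    have hmodel : (1 - η₂) * (κ_m * w * δ) ≤ (1 - η₂) * (m i x - m i xplus) :=
      mul_le_mul_of_nonneg_left (hdec i) (sub_nonneg.2 hη.2.le)
    have herror := (abs_le.1 (herr i xplus hxplus)).2
    rw [ge_iff_le, le_div_iff₀ hpos]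
    linarith [hinterp i]
  have : Nonempty (Fin p) := ⟨⟨0, hp⟩⟩
  exact ⟨hratio, le_ciInf hratio⟩
end
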